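/- With $V$ defined as in the previous statement and $H := \limsup_{\rho\to\infty}\Big[\big(\int_\rho^\infty \psi^{1-m}\big)\big(\int_0^\rho a_0\psi^{m-1}\big) - \int_0^\rho\big(\int_t^\infty \psi^{1-m}\big)a_0\psi^{m-1}\,dt\Big]$ subtracted, i.e. $\tilde V(r) = V(r) - H$: if moreover $\int_0^\infty\big(\int_t^\infty \psi^{1-m}(\xi)\,d\xi\big)a_0(t)\psi^{m-1}(t)\,dt < \infty$, then $\lim_{r\to\infty} \tilde V(r) = 0$ and $\tilde V(r) > 0$ for all $r \geq 0$. -/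

import Mathlib

open MeasureTheory Set intervalIntegral Filter

theorem stmt2 (m : ℕ) (hm : 2 ≤ m) (ψ a0 V : ℝ → ℝ) (H : ℝ)
    (hψcont : ContinuousOn ψ (Set.Ioi 0))
    (hψpos : ∀ r > 0, 0 < ψ r)
    (hint : MeasureTheory.IntegrableOn (fun ξ => 1 / ψ ξ ^ (m - 1)) (Set.Ioi 1))
    (ha0 : Continuous a0) (ha0pos : ∀ r ≥ 0, 0 < a0 r)
    (hint2 : MeasureTheory.IntegrableOn
      (fun t => (∫ ξ in Set.Ioi t, 1 / ψ ξ ^ (m - 1)) * (a0 t * ψ t ^ (m - 1))) (Set.Ioi 0))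
    (hV : V = fun r => (∫ ξ in Set.Ioi r, 1 / ψ ξ ^ (m - 1)) * (∫ t in (0:ℝ)..r, a0 t * ψ t ^ (m - 1))
        - ∫ t in (0:ℝ)..r, (∫ ξ in Set.Ioi t, 1 / ψ ξ ^ (m - 1)) * (a0 t * ψ t ^ (m - 1)))
    (hH : H = Filter.limsup V Filter.atTop) :
    Filter.Tendsto (fun r => V r - H) Filter.atTop (nhds 0) ∧
    ∀ r ≥ (0:ℝ), 0 < V r - H := by
  set f : ℝ → ℝ := fun ξ => 1 / ψ ξ ^ (m - 1) with hf
  set w : ℝ → ℝ := fun t => a0 t * ψ t ^ (m - 1) with hw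
  set G : ℝ → ℝ := fun t => ∫ ξ in Set.Ioi t, f ξ with hG
  have hfpos : ∀ r > 0, 0 < f r := fun r hr => one_div_pos.2 (pow_pos (hψpos r hr) _)
  have hwpos : ∀ r > 0, 0 < w r := fun r hr =>
    mul_pos (ha0pos r hr.le) (pow_pos (hψpos r hr) _)
  have hfc : ContinuousOn f (Set.Ioi 0) :=
    continuousOn_const.div (hψcont.pow _) (fun x hx => (pow_pos (hψpos x hx) _).ne')
  have hwc : ContinuousOn w (Set.Ioi 0) := ha0.continuousOn.mul (hψcont.pow _)
  have hfI : ∀ t > 0, IntegrableOn f (Set.Ioi t) := by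
    intro t ht
    have h1 : IntegrableOn f (Set.Icc t 1) :=
      (hfc.mono (fun x hx => lt_of_lt_of_le ht hx.1)).integrableOn_Icc
    refine (h1.union hint).mono_set ?_
    intro x hx
    rcases le_or_gt x 1 with h | h
    · exact Or.inl ⟨le_of_lt hx, h⟩
    · exact Or.inr h
  have hfii : ∀ s > 0, ∀ r, s ≤ r → IntervalIntegrable f volume s r := by
    intro s hs r hsr
    rw [intervalIntegrable_iff_integrableOn_Ioc_of_le hsr]
    exact (hfI s hs).mono_set Ioc_subset_Ioi_self
  have hGsub : ∀ s > 0, ∀ r, s < r → 0 < G s - G r := by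
    intro s hs r hsr
    have h1 : G s = (∫ x in Set.Ioc s r, f x) + G r := by
      simp only [hG]
      rw [← setIntegral_union (Ioc_disjoint_Ioi le_rfl) measurableSet_Ioi
        ((hfI s hs).mono_set Ioc_subset_Ioi_self) (hfI r (hs.trans hsr)),
        Ioc_union_Ioi_eq_Ioi hsr.le]
    have h2 : 0 < ∫ x in s..r, f x :=
      intervalIntegral_pos_of_pos_on (hfii s hs r hsr.le)
        (fun x hx => hfpos x (hs.trans hx.1)) hsr
    rw [integral_of_le hsr.le] at h2
    linarith
  have hGnn : ∀ s > 0, 0 ≤ G s := fun s hs =>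
    setIntegral_nonneg measurableSet_Ioi (fun x hx => (hfpos x (hs.trans hx)).le)
  have hGpos : ∀ s > 0, 0 < G s := by
    intro s hs
    have := hGsub s hs (s+1) (by linarith)
    have := hGnn (s+1) (by linarith)
    linarith
  have hKI : IntegrableOn (fun t => G t * w t) (Set.Ioi 0) := hint2
  have hwI : ∀ r > 0, IntegrableOn w (Set.Ioc 0 r) := by
    intro r hr
    have h1 : IntegrableOn (fun t => (G r)⁻¹ * (G t * w t)) (Set.Ioc 0 r) :=
      (hKI.mono_set Ioc_subset_Ioi_self).const_mul _
    refine Integrable.mono' h1 ?_ ?_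
    · exact (hwc.mono Ioc_subset_Ioi_self).aestronglyMeasurable measurableSet_Ioc
    · refine (ae_restrict_iff' measurableSet_Ioc).2 (Eventually.of_forall ?_)
      intro t ht
      have hw0 := hwpos t ht.1
      rw [Real.norm_of_nonneg hw0.le]
      have hle : G r ≤ G t := by
        rcases ht.2.lt_or_eq with h | h
        · linarith [hGsub t ht.1 r h]
        · rw [h]
      have hp := hGpos r hr
      rw [inv_mul_eq_div, le_div_iff₀ hp]
      nlinarith
  have hwii : ∀ r ≥ 0, IntervalIntegrable w volume 0 r := by
    intro r hr
    rcases hr.lt_or_eq with h | h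
    · exact (intervalIntegrable_iff_integrableOn_Ioc_of_le hr).2 (hwI r h)
    · rw [← h]
  have hKii : ∀ r ≥ 0, IntervalIntegrable (fun t => G t * w t) volume 0 r := by
    intro r hr
    exact (intervalIntegrable_iff_integrableOn_Ioc_of_le hr).2
      (hKI.mono_set Ioc_subset_Ioi_self)
  have hVr : ∀ r, V r = G r * (∫ t in (0:ℝ)..r, w t) - ∫ t in (0:ℝ)..r, G t * w t := by
    intro r; rw [hV]
  have hWnn : ∀ r ≥ 0, 0 ≤ ∫ t in (0:ℝ)..r, w t := by
    intro r hr
    rw [integral_of_le hr]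
    exact setIntegral_nonneg measurableSet_Ioc (fun x hx => (hwpos x hx.1).le)
  have hanti : ∀ s ≥ 0, ∀ r, s < r → V r < V s := by
    intro s hs r hsr
    have hr : 0 < r := lt_of_le_of_lt hs hsr
    have w2 : IntervalIntegrable w volume s r := (hwii s hs).symm.trans (hwii r hr.le)
    have k2 : IntervalIntegrable (fun t => G t * w t) volume s r :=
      (hKii s hs).symm.trans (hKii r hr.le)
    have e1 := integral_add_adjacent_intervals (hwii s hs) w2
    have e2 := integral_add_adjacent_intervals (hKii s hs) k2
    have h3 : 0 < ∫ t in s..r, (G t * w t - G r * w t) := by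
      refine intervalIntegral_pos_of_pos_on (k2.sub (w2.const_mul _)) ?_ hsr
      intro x hx
      have hx0 : 0 < x := lt_of_le_of_lt hs hx.1
      have := mul_pos (hGsub x hx0 r hx.2) (hwpos x hx0)
      linarith
    rw [intervalIntegral.integral_sub k2 (w2.const_mul _),
      intervalIntegral.integral_const_mul] at h3
    have h4 : 0 ≤ (G s - G r) * ∫ t in (0:ℝ)..s, w t := by
      rcases hs.lt_or_eq with h | h
      · exact mul_nonneg (hGsub s h r hsr).le (hWnn s hs)
      · rw [← h]; simp
    rw [hVr, hVr, ← e1, ← e2]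
    linarith
  have hbdd : ∀ r > 0, -(∫ t in Set.Ioi 0, G t * w t) ≤ V r := by
    intro r hr
    have h1 := mul_nonneg (hGnn r hr) (hWnn r hr.le)
    have h2 : ∫ t in (0:ℝ)..r, G t * w t ≤ ∫ t in Set.Ioi 0, G t * w t := by
      rw [integral_of_le hr.le]
      refine setIntegral_mono_set hKI ?_ (Ioc_subset_Ioi_self.eventuallyLE)
      refine (ae_restrict_iff' measurableSet_Ioi).2 (Eventually.of_forall ?_)
      intro t ht
      exact mul_nonneg (hGnn t ht) (hwpos t ht).le
    rw [hVr]
    linarith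
  have hA : Antitone (fun r => V (max r 1)) := by
    intro x y hxy
    rcases (max_le_max_right 1 hxy).lt_or_eq with h | h
    · exact (hanti _ (by positivity) _ h).le
    · simp only [h]; exact le_rfl
  have hB : BddBelow (Set.range (fun r => V (max r 1))) := by
    refine ⟨-(∫ t in Set.Ioi 0, G t * w t), ?_⟩
    rintro _ ⟨x, rfl⟩
    exact hbdd _ (by positivity)
  have hT0 := tendsto_atTop_ciInf hA hB
  have hT : Tendsto V atTop (nhds (⨅ r, V (max r 1))) := by
    refine hT0.congr' ?_
    filter_upwards [eventually_ge_atTop 1] with x hx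
    rw [max_eq_left hx]
  have hHe : H = ⨅ r, V (max r 1) := by rw [hH]; exact hT.limsup_eq
  rw [← hHe] at hT
  refine ⟨by simpa using hT.sub_const H, ?_⟩
  intro r hr
  have h1 := hanti r hr (r+1) (by linarith)
  have h2 : H ≤ V (r+1) := by
    rw [hHe]
    have := ciInf_le hB (r+1)
    simpa [max_eq_left (show (1:ℝ) ≤ r+1 by linarith)] using this
  linarith
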